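/- (Goldberg, existence) Let d ≥ 2 be an integer, let p, q be coprime integers with q ≥ 1 and 0 ≤ p < q, let k be an integer with 1 ≤ k ≤ d-1, and let s_1 ≤ s_2 ≤ ... ≤ s_{d-1} be integers with 0 ≤ s_1 and s_{d-1} = k·q such that every residue class modulo k is realized by some s_j. Then there exists a strictly increasing function θ : {0, 1, ..., kq-1} → ℝ with 0 ≤ θ_0 and θ_{kq-1} < 1 such that d·θ_i - θ_{(i+kp) mod kq} ∈ ℤ for every index i, and for every i ∈ {1, ..., d-1} the cardinality #{j : θ_j < i/(d-1)} equals s_i. -/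

import Mathlib

/-- The lifted deployment counting function: for `0 ≤ x < n` it is the number of `l` with
`s l ≤ x`, and `x + n` is counted `r` times more than `x`. -/
def deploymentCount {r : ℕ} (n : ℤ) (s : Fin r → ℤ) (x : ℤ) : ℤ :=
  ∑ l, ((x - s l) / n + 1)

/-- The value in base `d` of the word `f 0, f 1, …, f (q - 1)`, most significant digit first. -/
def wordValue (d : ℝ) (q : ℕ) (f : ℕ → ℝ) : ℝ :=
  ∑ t ∈ Finset.range q, f t * d ^ (q - 1 - t)

/-- The lift to `ℤ` of the rotation set with `n` angles, rotation `m / n` of order `q` winding `p`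
times, and deployment sequence `s`. -/
noncomputable def liftedAngle {r : ℕ} (d : ℝ) (q p : ℕ) (m n : ℤ) (s : Fin r → ℤ) (x : ℤ) : ℝ :=
  (wordValue d q (fun t => (deploymentCount n s (x + t * m) : ℝ)) + p) / (d ^ q - 1)

section deploymentCount

variable {r : ℕ} {n : ℤ} {s : Fin r → ℤ}

theorem deploymentCount_add_mul (hn : 0 < n) (x c : ℤ) :
    deploymentCount n s (x + c * n) = deploymentCount n s x + c * r := by
  have h : ∀ l, (x + c * n - s l) / n + 1 = ((x - s l) / n + 1) + c := by
    intro l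
    rw [show x + c * n - s l = (x - s l) + c * n by ring, Int.add_mul_ediv_right _ _ hn.ne']
    ring
  simp only [deploymentCount, h, Finset.sum_add_distrib]
  simp
  ring

theorem deploymentCount_mono (hn : 0 < n) : Monotone (deploymentCount n s) := by
  intro x y hxy
  refine Finset.sum_le_sum fun l _ => ?_
  have := Int.ediv_le_ediv hn (show x - s l ≤ y - s l by lia)
  lia

theorem deploymentCount_lt_succ (hn : 0 < n) {x : ℤ} {l : Fin r} (h : n ∣ x + 1 - s l) :
    deploymentCount n s x < deploymentCount n s (x + 1) := by
  refine Finset.sum_lt_sum (fun j _ => ?_) ⟨l, Finset.mem_univ _, ?_⟩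
  · have := Int.ediv_le_ediv hn (show x - s j ≤ x + 1 - s j by lia)
    lia
  · have : (x - s l) / n < (x + 1 - s l) / n := by
      obtain ⟨c, hc⟩ := h
      rw [hc, Int.mul_ediv_cancel_left _ hn.ne']
      refine Int.ediv_lt_of_lt_mul hn ?_
      linarith [mul_comm n c]
    lia

theorem deploymentCount_eq_card (hs : ∀ l, 0 ≤ s l ∧ s l ≤ n) {x : ℤ} (hx : 0 ≤ x) (hxn : x < n) :
    deploymentCount n s x = (Finset.univ.filter fun l => s l ≤ x).card := by
  rw [Finset.card_filter]
  push_cast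
  refine Finset.sum_congr rfl fun l _ => ?_
  obtain ⟨h0, h1⟩ := hs l
  split_ifs with h
  · rw [Int.ediv_eq_zero_of_lt (by lia) (by lia)]
    rfl
  · have : (x - s l) / n = -1 := by
      rw [Int.ediv_eq_iff_of_pos (by lia)]
      constructor <;> lia
    lia

theorem deploymentCount_le_iff (hs : ∀ l, 0 ≤ s l ∧ s l ≤ n) (hmono : Monotone s) {x : ℤ}
    (hx : 0 ≤ x) (hxn : x < n) (j : Fin r) :
    deploymentCount n s x ≤ (j : ℕ) ↔ x < s j := by
  rw [deploymentCount_eq_card hs hx hxn, Nat.cast_le]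
  constructor
  · intro h
    by_contra! hj
    have : (Finset.Iic j).card ≤ (Finset.univ.filter fun l => s l ≤ x).card := by
      refine Finset.card_le_card fun l hl => ?_
      simp only [Finset.mem_filter, Finset.mem_univ, true_and]
      exact (hmono (Finset.mem_Iic.mp hl)).trans hj
    rw [Fin.card_Iic] at this
    lia
  · intro h
    rw [← Fin.card_Iio j]
    refine Finset.card_le_card fun l hl => ?_
    simp only [Finset.mem_filter, Finset.mem_univ, true_and] at hl
    rw [Finset.mem_Iio]
    by_contra! hj
    exact absurd (hmono hj) (by lia)

end deploymentCount

theorem mul_wordValue_sub_shift (d : ℝ) (q : ℕ) (f : ℕ → ℝ) :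
    d * wordValue d q f - wordValue d q (fun t => f (t + 1)) = f 0 * d ^ q - f q := by
  have hsucc : ∀ (q : ℕ) (g : ℕ → ℝ), wordValue d (q + 1) g = d * wordValue d q g + g q := by
    intro q g
    simp only [wordValue, Finset.sum_range_succ, Finset.mul_sum]
    congr 1
    · refine Finset.sum_congr rfl fun t ht => ?_
      have := Finset.mem_range.mp ht
      rw [show q + 1 - 1 - t = (q - 1 - t) + 1 by lia, pow_succ]
      ring
    · simp
  induction q with
  | zero => simp [wordValue]
  | succ q ih =>
    rw [hsucc, hsucc, pow_succ]
    linear_combination d * ih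

theorem wordValue_add_const (d : ℝ) (q : ℕ) (f : ℕ → ℝ) (c : ℝ) :
    wordValue d q (fun t => f t + c * (d - 1)) = wordValue d q f + c * (d ^ q - 1) := by
  have h := mul_wordValue_sub_shift d q (fun _ => 1)
  simp only [wordValue, add_mul, Finset.sum_add_distrib] at h ⊢
  rw [← Finset.mul_sum]
  simp only [one_mul] at h ⊢
  linear_combination c * h

section liftedAngle

variable {r : ℕ} {d : ℝ} {q p : ℕ} {m n : ℤ} {s : Fin r → ℤ}

theorem liftedAngle_add_period (hd : 1 < d) (hr : (r : ℝ) = d - 1) (hq : q ≠ 0) (hn : 0 < n)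
    (x : ℤ) : liftedAngle d q p m n s (x + n) = liftedAngle d q p m n s x + 1 := by
  have hpow : d ^ q - 1 ≠ 0 := (sub_pos.mpr (one_lt_pow₀ hd hq)).ne'
  have h : ∀ t : ℕ, (deploymentCount n s (x + n + t * m) : ℝ)
      = (deploymentCount n s (x + t * m) : ℝ) + 1 * (d - 1) := by
    intro t
    rw [show x + n + t * m = x + t * m + 1 * n by ring, deploymentCount_add_mul hn, ← hr]
    push_cast
    ring
  simp only [liftedAngle, h]
  rw [wordValue_add_const]
  field_simp
  ring

theorem mul_liftedAngle (hd : 1 < d) (hr : (r : ℝ) = d - 1) (hq : q ≠ 0) (hn : 0 < n)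
    (hqm : q * m = p * n) (x : ℤ) :
    d * liftedAngle d q p m n s x = liftedAngle d q p m n s (x + m) + deploymentCount n s x := by
  have hpow : d ^ q - 1 ≠ 0 := (sub_pos.mpr (one_lt_pow₀ hd hq)).ne'
  have h := mul_wordValue_sub_shift d q (fun t => (deploymentCount n s (x + t * m) : ℝ))
  have hshift : ∀ t : ℕ, x + m + t * m = x + ((t + 1 : ℕ) : ℤ) * m := by
    intro t
    push_cast
    ring
  rw [hqm, deploymentCount_add_mul hn] at h
  simp only [liftedAngle, hshift]
  push_cast at h ⊢
  rw [hr] at h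
  simp only [zero_mul, add_zero] at h
  field_simp
  linear_combination h

theorem liftedAngle_strictMono (hd : 1 < d) (hq : q ≠ 0) (hn : 0 < n)
    (hjump : ∀ x : ℤ, ∃ t < q, ∃ l, n ∣ x + t * m + 1 - s l) :
    StrictMono (liftedAngle d q p m n s) := by
  refine strictMono_int_of_lt_succ fun x => ?_
  have hpow : 0 < d ^ q - 1 := sub_pos.mpr (one_lt_pow₀ hd hq)
  have hd0 : 0 < d := by linarith
  refine div_lt_div_of_pos_right (add_lt_add_left ?_ _) hpow
  obtain ⟨t, ht, l, hl⟩ := hjump x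
  refine Finset.sum_lt_sum (fun u _ => ?_) ⟨t, Finset.mem_range.mpr ht, ?_⟩
  · refine mul_le_mul_of_nonneg_right (Int.cast_le.mpr ?_) (by positivity)
    exact deploymentCount_mono hn (by linarith)
  · refine mul_lt_mul_of_pos_right (Int.cast_lt.mpr ?_) (by positivity)
    rw [show x + 1 + t * m = x + t * m + 1 by ring]
    exact deploymentCount_lt_succ hn hl

theorem liftedAngle_nonneg (hd : 1 < d) (hm : 0 ≤ m) (hn : 0 < n)
    (hs : ∀ l, 0 ≤ s l ∧ s l ≤ n) {x : ℤ} (hx : 0 ≤ x) : 0 ≤ liftedAngle d q p m n s x := by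
  have hd0 : 0 < d := by linarith
  refine div_nonneg (add_nonneg (Finset.sum_nonneg fun t _ => ?_) (by positivity))
    (sub_nonneg.mpr (one_le_pow₀ hd.le))
  refine mul_nonneg (Int.cast_nonneg ?_) (by positivity)
  have h0 : 0 ≤ deploymentCount n s 0 := by
    rw [deploymentCount_eq_card hs le_rfl hn]
    positivity
  exact h0.trans (deploymentCount_mono hn (by positivity))

theorem liftedAngle_lt_iff (hd : 1 < d) (hr : (r : ℝ) = d - 1) (hq : q ≠ 0) (hn : 0 < n)
    (hqm : q * m = p * n) (hm : 0 ≤ m) (hmn : m < n) (hs : ∀ l, 0 ≤ s l ∧ s l ≤ n)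
    (hmono : Monotone s) (hθ : StrictMono (liftedAngle d q p m n s)) {x : ℤ}
    (hx : 0 ≤ x) (hxn : x < n) (j : Fin r) :
    liftedAngle d q p m n s x < ((j : ℕ) + 1 : ℝ) / (d - 1) ↔ x < s j := by
  rw [← deploymentCount_le_iff hs hmono hx hxn, lt_div_iff₀ (by linarith)]
  have h := mul_liftedAngle (s := s) hd hr hq hn hqm x
  have hlow := hθ.monotone (show x ≤ x + m by lia)
  have hup := hθ (show x + m < x + n by lia)
  rw [liftedAngle_add_period hd hr hq hn] at hup
  rw [← Int.lt_add_one_iff]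
  constructor
  · intro hlt
    have : (deploymentCount n s x : ℝ) < ((j : ℕ) : ℝ) + 1 := by nlinarith
    exact_mod_cast this
  · intro hle
    have : (deploymentCount n s x : ℝ) ≤ ((j : ℕ) : ℝ) := by
      exact_mod_cast Int.lt_add_one_iff.mp hle
    nlinarith

end liftedAngle

/-- Stepping by `k * p` modulo `k * q`, with `p` and `q` coprime, reaches every integer of the
same residue class modulo `k`. -/
theorem exists_lt_dvd_add_mul_sub {k p q : ℕ} (hq : 1 ≤ q) (hcop : Nat.Coprime p q) {x y : ℤ}
    (h : (k : ℤ) ∣ y - x) : ∃ t < q, ((k * q : ℕ) : ℤ) ∣ x + t * ((k * p : ℕ) : ℤ) - y := by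
  obtain ⟨c, hc⟩ := h
  have : NeZero q := ⟨by lia⟩
  refine ⟨((c : ZMod q) * (p : ZMod q)⁻¹).val, ZMod.val_lt _, ?_⟩
  have hdvd : (q : ℤ) ∣ ((((c : ZMod q) * (p : ZMod q)⁻¹).val : ℕ) : ℤ) * p - c := by
    rw [← ZMod.intCast_zmod_eq_zero_iff_dvd]
    push_cast
    rw [ZMod.natCast_zmod_val, mul_assoc, mul_comm _ (p : ZMod q), ZMod.coe_mul_inv_eq_one p hcop]
    ring
  obtain ⟨e, he⟩ := hdvd
  refine ⟨e, ?_⟩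
  push_cast
  linear_combination (k : ℤ) * he - hc


theorem goldberg_existence (d p q k : ℕ) (hd : 2 ≤ d) (hq : 1 ≤ q) (hp : p < q)
    (hcop : Nat.Coprime p q) (hk1 : 1 ≤ k) (hk2 : k ≤ d - 1)
    (s : Fin (d - 1) → ℤ) (hmono : Monotone s)
    (hs0 : (0 : ℤ) ≤ s ⟨0, by omega⟩) (hslast : s ⟨d - 2, by omega⟩ = (k : ℤ) * q)
    (hres : ∀ r : ZMod k, ∃ j : Fin (d - 1), ((s j : ℤ) : ZMod k) = r) :
    ∃ θ : Fin (k * q) → ℝ, StrictMono θ ∧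
      0 ≤ θ ⟨0, Nat.mul_pos hk1 hq⟩ ∧
      θ ⟨k * q - 1, Nat.sub_lt (Nat.mul_pos hk1 hq) one_pos⟩ < 1 ∧
      (∀ i : Fin (k * q), ∃ N : ℤ,
        (d : ℝ) * θ i - θ ⟨(i.val + k * p) % (k * q),
          Nat.mod_lt _ (Nat.mul_pos hk1 hq)⟩ = N) ∧
      ∀ i : Fin (d - 1),
        ({j : Fin (k * q) | θ j < ((i : ℕ) + 1 : ℝ) / ((d : ℝ) - 1)}.ncard : ℤ) =
          s i := by
  have hn : 0 < k * q := Nat.mul_pos hk1 hq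
  have hd1 : (1 : ℝ) < d := by exact_mod_cast hd
  have hr : ((d - 1 : ℕ) : ℝ) = (d : ℝ) - 1 := by
    rw [Nat.cast_sub (by lia)]
    simp
  have hnZ : (0 : ℤ) < ((k * q : ℕ) : ℤ) := by exact_mod_cast hn
  have hmn : ((k * p : ℕ) : ℤ) < ((k * q : ℕ) : ℤ) := by
    exact_mod_cast Nat.mul_lt_mul_of_pos_left hp hk1
  have hqm : (q : ℤ) * ((k * p : ℕ) : ℤ) = p * ((k * q : ℕ) : ℤ) := by
    push_cast
    ring
  have hs : ∀ l, 0 ≤ s l ∧ s l ≤ ((k * q : ℕ) : ℤ) := by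
    intro l
    refine ⟨hs0.trans (hmono (Fin.mk_le_of_le_val (Nat.zero_le _))), ?_⟩
    push_cast
    rw [← hslast]
    refine hmono (Fin.le_def.mpr ?_)
    have := l.isLt
    simp only
    lia
  set φ : ℤ → ℝ := liftedAngle d q p ((k * p : ℕ) : ℤ) ((k * q : ℕ) : ℤ) s with hφ
  have hθ : StrictMono φ := by
    refine liftedAngle_strictMono hd1 (by lia) hnZ fun x => ?_
    obtain ⟨l, hl⟩ := hres ((x + 1 : ℤ) : ZMod k)
    have hdvd : (k : ℤ) ∣ s l - (x + 1) := by
      rw [← ZMod.intCast_zmod_eq_zero_iff_dvd, Int.cast_sub, hl, sub_self]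
    obtain ⟨t, ht, htd⟩ := exists_lt_dvd_add_mul_sub hq hcop hdvd
    refine ⟨t, ht, l, ?_⟩
    rwa [add_right_comm]
  have hiff : ∀ (i : Fin (k * q)) (j : Fin (d - 1)),
      φ (i : ℕ) < ((j : ℕ) + 1 : ℝ) / ((d : ℝ) - 1) ↔ ((i : ℕ) : ℤ) < s j := fun i j =>
    liftedAngle_lt_iff hd1 hr (by lia) hnZ hqm (by positivity) hmn hs hmono hθ
      (by positivity) (by exact_mod_cast i.isLt) j
  refine ⟨fun i => φ (i : ℕ), fun a b hab => hθ (by exact_mod_cast hab),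
    liftedAngle_nonneg hd1 (by positivity) hnZ hs (by positivity), ?_, fun i => ?_, fun i => ?_⟩
  · have h := (hiff ⟨k * q - 1, Nat.sub_lt hn one_pos⟩ ⟨d - 2, by lia⟩).mpr (by
      rw [hslast]
      have : ((k * q - 1 : ℕ) : ℤ) < ((k * q : ℕ) : ℤ) := by exact_mod_cast Nat.sub_lt hn one_pos
      exact_mod_cast this)
    have hlast : (((d - 2 : ℕ) : ℝ) + 1) / ((d : ℝ) - 1) = 1 := by
      rw [Nat.cast_sub hd, div_eq_one_iff_eq (by linarith)]
      push_cast
      ring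
    exact h.trans_eq hlast
  · have hmul := mul_liftedAngle (s := s) hd1 hr (by lia) hnZ hqm ((i : ℕ) : ℤ)
    rw [← hφ] at hmul
    rcases lt_or_ge (i.val + k * p) (k * q) with hlt | hge
    · refine ⟨deploymentCount ((k * q : ℕ) : ℤ) s (i : ℕ), ?_⟩
      simp only [Nat.mod_eq_of_lt hlt]
      rw [hmul, ← Nat.cast_add]
      ring
    · refine ⟨deploymentCount ((k * q : ℕ) : ℤ) s (i : ℕ) + 1, ?_⟩
      have hmn' : k * p < k * q := by exact_mod_cast hmn
      have hmod : (i.val + k * p) % (k * q) = i.val + k * p - k * q := by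
        rw [Nat.mod_eq_sub_mod hge, Nat.mod_eq_of_lt (by have := i.isLt; omega)]
      have hper := liftedAngle_add_period (p := p) (m := ((k * p : ℕ) : ℤ)) (s := s) hd1 hr
        (show q ≠ 0 by lia) hnZ ((i.val + k * p - k * q : ℕ) : ℤ)
      rw [← hφ, ← Nat.cast_add, Nat.sub_add_cancel hge] at hper
      simp only [hmod]
      rw [hmul, ← Nat.cast_add, hper]
      push_cast
      ring
  · obtain ⟨c, hc⟩ := Int.eq_ofNat_of_zero_le (hs i).1
    have hle : c ≤ k * q := by exact_mod_cast hc ▸ (hs i).2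
    simp only [hiff, hc, Nat.cast_lt]
    rw [Set.ncard_eq_toFinset_card', Set.toFinset_ofPred, Fin.card_filter_val_lt, min_eq_right hle]
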